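/- Let A be a Noetherian ring, f : A → B a ring homomorphism, and J an ideal of B with J ⊆ Nil(B) which is finitely generated as an A-module. Then A⋈^f J is Cohen-Macaulay if and only if A is Cohen-Macaulay and J_𝔭 is a maximal Cohen-Macaulay A_𝔭-module for every prime ideal 𝔭 ∈ Supp_A(J). -/

import Mathlib

/-- The Koszul cochain differential of the complex `Hom(K_•(x), M)`, described explicitly:
the degree-`i` term is the module of `M`-valued functions on the `i`-element subsets of
`Fin n`, and the differential is the usual alternating-sum formula. -/
noncomputable def koszulMap (A : Type*) [CommRing A] (M : Type*) [AddCommGroup M]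
    [Module A M] {n : ℕ} (x : Fin n → A) (i : ℕ) :
    ({s : Finset (Fin n) // s.card = i} → M) →ₗ[A]
      ({s : Finset (Fin n) // s.card = i + 1} → M) where
  toFun g t := ∑ j ∈ t.1.attach,
    (((-1 : A) ^ ((t.1.filter (fun k => k < j.1)).card)) * x j.1) •
      g ⟨t.1.erase j.1, by
        rw [Finset.card_erase_of_mem j.2, t.2]; omega⟩

  map_add' g h := funext fun t => by
    simp [smul_add, Finset.sum_add_distrib]
  map_smul' a g := funext fun t => by
    simp only [Pi.smul_apply, RingHom.id_apply, Finset.smul_sum]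
    exact Finset.sum_congr rfl fun j _ => by
      rw [smul_smul, smul_smul, mul_comm]

/-- Nonvanishing of the `i`-th cohomology `H^i(Hom(K_•(x), M))` of the Koszul
cochain complex. -/
def koszulCohomologyNeZero (A : Type*) [CommRing A] (M : Type*) [AddCommGroup M]
    [Module A M] {n : ℕ} (x : Fin n → A) : ℕ → Prop
  | 0 => LinearMap.ker (koszulMap A M x 0) ≠ ⊥
  | (i + 1) => ¬ (LinearMap.ker (koszulMap A M x (i + 1)) ≤
      LinearMap.range (koszulMap A M x i))

/-- The Koszul grade of a finite sequence `x` on `M`: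
`inf { i : H^i(Hom(K_•(x), M)) ≠ 0 }` (an element of `ℕ∞`, equal to `⊤` if all
cohomology vanishes). -/
noncomputable def kgrSeq (A : Type*) [CommRing A] (M : Type*) [AddCommGroup M]
    [Module A M] {n : ℕ} (x : Fin n → A) : ℕ∞ :=
  sInf {i : ℕ∞ | ∃ k : ℕ, i = k ∧ koszulCohomologyNeZero A M x k}

/-- The Koszul grade `kgr_A(𝔞, M)` of an arbitrary ideal `𝔞` on `M`: the supremum of the
Koszul grades of finite sequences contained in `𝔞` (equivalently, of the finitely
generated subideals of `𝔞`). -/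
noncomputable def kgr (A : Type*) [CommRing A] (𝔞 : Ideal A) (M : Type*)
    [AddCommGroup M] [Module A M] : ℕ∞ :=
  ⨆ (n : ℕ) (x : Fin n → A) (_ : ∀ j, x j ∈ 𝔞), kgrSeq A M x

/-- The height of an ideal: the infimum of the heights of the primes containing it. -/
noncomputable def idealHeight (A : Type*) [CommRing A] (𝔞 : Ideal A) : ℕ∞ :=
  ⨅ (p : PrimeSpectrum A) (_ : 𝔞 ≤ p.asIdeal), Order.height p

/-- A commutative ring `R` is Cohen-Macaulay in the sense of a class `𝒜` of ideals if
`height 𝔞 = kgr_R(𝔞, R)` for every `𝔞 ∈ 𝒜`. -/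
def IsCMSense (R : Type*) [CommRing R] (𝒜 : Set (Ideal R)) : Prop :=
  ∀ 𝔞 ∈ 𝒜, idealHeight R 𝔞 = kgr R 𝔞 R

/-- Cohen-Macaulay in the sense of ideals. -/
def IsCMIdeals (R : Type*) [CommRing R] : Prop :=
  ∀ 𝔞 : Ideal R, idealHeight R 𝔞 = kgr R 𝔞 R

/-- Cohen-Macaulay in the sense of maximal ideals. -/
def IsCMMaximal (R : Type*) [CommRing R] : Prop :=
  ∀ 𝔪 : Ideal R, 𝔪.IsMaximal → idealHeight R 𝔪 = kgr R 𝔪 R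

/-- The amalgamation `A ⋈^f J = {(a, f a + j) : a ∈ A, j ∈ J}` of `A` with `B` along the
ideal `J` of `B` with respect to `f : A →+* B`, as a subring of `A × B`. -/
def amalgamation {A B : Type*} [CommRing A] [CommRing B] (f : A →+* B) (J : Ideal B) :
    Subring (A × B) where
  carrier := {p | p.2 - f p.1 ∈ J}
  zero_mem' := by simp
  one_mem' := by simp
  add_mem' := fun {p q} hp hq => by
    have := J.add_mem hp hq
    simpa [add_sub_add_comm] using this
  neg_mem' := fun {p} hp => by
    show (-p).2 - f ((-p).1) ∈ J
    have key : (-p).2 - f ((-p).1) = -(p.2 - f p.1) := by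
      simp only [Prod.fst_neg, Prod.snd_neg, map_neg]; ring
    rw [key]
    exact J.neg_mem hp
  mul_mem' := fun {p q} hp hq => by
    show (p * q).2 - f ((p * q).1) ∈ J
    have key : (p * q).2 - f ((p * q).1)
        = p.2 * (q.2 - f q.1) + (p.2 - f p.1) * f q.1 := by
      simp only [Prod.fst_mul, Prod.snd_mul, map_mul]; ring
    rw [key]
    exact J.add_mem (J.mul_mem_left _ hq) (J.mul_mem_right _ hp)

/-- The natural embedding `ι_A : A → A ⋈^f J`, `a ↦ (a, f a)`. -/
def amalgIota {A B : Type*} [CommRing A] [CommRing B] (f : A →+* B) (J : Ideal B) :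
    A →+* amalgamation f J where
  toFun a := ⟨(a, f a), show (a, f a).2 - f (a, f a).1 ∈ J by simp⟩
  map_one' := Subtype.ext (by simp)
  map_mul' a b := Subtype.ext (by simp)
  map_zero' := Subtype.ext (by simp)
  map_add' a b := Subtype.ext (by simp)

/-- The extension `𝔞^e = 𝔞(A ⋈^f J)` of an ideal `𝔞` of `A` along `ι_A`. -/
noncomputable def idealExt {A B : Type*} [CommRing A] [CommRing B] (f : A →+* B)
    (J : Ideal B) (𝔞 : Ideal A) : Ideal ↥(amalgamation f J) :=
  Ideal.map (amalgIota f J) 𝔞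

/-- `kgr_A(𝔞, J)` where the ideal `J` of `B` is viewed as an `A`-module via `f`. -/
noncomputable def kgrIdeal {A B : Type*} [CommRing A] [CommRing B] (f : A →+* B)
    (J : Ideal B) (𝔞 : Ideal A) : ℕ∞ :=
  letI : Module A J := Module.compHom J f
  kgr A 𝔞 J

/-- The ideal `𝔭'^f = 𝔭 ⋈^f J = {(p, f p + j) : p ∈ 𝔭, j ∈ J}` of `A ⋈^f J`. -/
def primeAmalg {A B : Type*} [CommRing A] [CommRing B] (f : A →+* B) (J : Ideal B)
    (𝔭 : Ideal A) : Ideal ↥(amalgamation f J) where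
  carrier := {z | (z : A × B).1 ∈ 𝔭}
  zero_mem' := by simp
  add_mem' := fun {a b} ha hb => 𝔭.add_mem ha hb
  smul_mem' := fun c {z} hz => 𝔭.mul_mem_left (c : A × B).1 hz

/-- The ideal `𝔮̄^f = {(a, f a + j) : a ∈ A, j ∈ J, f a + j ∈ 𝔮}` of `A ⋈^f J`. -/
def qbarAmalg {A B : Type*} [CommRing A] [CommRing B] (f : A →+* B) (J : Ideal B)
    (𝔮 : Ideal B) : Ideal ↥(amalgamation f J) where
  carrier := {z | (z : A × B).2 ∈ 𝔮}
  zero_mem' := by simp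
  add_mem' := fun {a b} ha hb => 𝔮.add_mem ha hb
  smul_mem' := fun c {z} hz => 𝔮.mul_mem_left (c : A × B).2 hz

/-- A ring homomorphism `f : A →+* B` satisfies the going-down property. -/
def RingHom.GoesDown {A B : Type*} [CommRing A] [CommRing B] (f : A →+* B) : Prop :=
  ∀ (𝔭' 𝔭 : Ideal A), 𝔭'.IsPrime → 𝔭.IsPrime → 𝔭' ≤ 𝔭 →
    ∀ 𝔮 : Ideal B, 𝔮.IsPrime → 𝔮.comap f = 𝔭 →
      ∃ 𝔮' : Ideal B, 𝔮'.IsPrime ∧ 𝔮' ≤ 𝔮 ∧ 𝔮'.comap f = 𝔭'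

section Koszul

variable {A : Type*} [CommRing A] {M : Type*} [AddCommGroup M] [Module A M] {n : ℕ}

/-- The sign with which `j` is inserted into, or deleted from, a finite set `t`. -/
def koszulSign (A : Type*) [CommRing A] (t : Finset (Fin n)) (j : Fin n) : A :=
  (-1) ^ (t.filter (fun k => k < j)).card

/-- The total Koszul differential, on `M`-valued functions on all subsets of `Fin n`. -/
def koszulDiff (x : Fin n → A) (G : Finset (Fin n) → M) (t : Finset (Fin n)) : M :=
  ∑ j ∈ t, (koszulSign A t j * x j) • G (t.erase j)

/-- The contracting homotopy of the Koszul complex attached to `j`. -/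
def koszulHomotopy (A : Type*) [CommRing A] [Module A M] (j : Fin n)
    (G : Finset (Fin n) → M) (t : Finset (Fin n)) : M :=
  if j ∈ t then 0 else koszulSign A t j • G (insert j t)

lemma koszulSign_mul_self (t : Finset (Fin n)) (j : Fin n) :
    koszulSign A t j * koszulSign A t j = 1 := by
  rw [koszulSign, ← mul_pow]; simp

lemma koszulSign_erase_of_le {j k : Fin n} (h : j ≤ k) (t : Finset (Fin n)) :
    koszulSign A (t.erase k) j = koszulSign A t j := by
  unfold koszulSign
  rw [Finset.filter_erase, Finset.erase_eq_of_notMem]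
  simp [h]

lemma koszulSign_erase_of_lt {j k : Fin n} (h : k < j) {t : Finset (Fin n)} (hk : k ∈ t) :
    koszulSign A (t.erase k) j = -koszulSign A t j := by
  unfold koszulSign
  have hm : k ∈ t.filter (fun l => l < j) := by simp [h, hk]
  rw [Finset.filter_erase, ← Finset.card_erase_add_one hm, pow_succ]
  simp

lemma koszulSign_swap {j k : Fin n} (hjk : j ≠ k) {t : Finset (Fin n)} (hj : j ∈ t)
    (hk : k ∈ t) :
    koszulSign A t k * koszulSign A (t.erase k) j =
      -(koszulSign A t j * koszulSign A (t.erase j) k) := by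
  rcases lt_or_gt_of_ne hjk with h | h
  · rw [koszulSign_erase_of_le h.le, koszulSign_erase_of_lt h hj]; ring
  · rw [koszulSign_erase_of_le h.le, koszulSign_erase_of_lt h hk]; ring

lemma koszulDiff_koszulDiff (x : Fin n → A) (G : Finset (Fin n) → M) :
    koszulDiff x (koszulDiff x G) = 0 := by
  funext t
  simp only [koszulDiff, Finset.smul_sum, smul_smul, Pi.zero_apply]
  rw [Finset.sum_sigma']
  refine Finset.sum_involution (fun p _ => ⟨p.2, p.1⟩) ?_ ?_ ?_ ?_
  · rintro ⟨j, k⟩ h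
    simp only [Finset.mem_sigma, Finset.mem_erase] at h
    rw [Finset.erase_right_comm, ← add_smul]
    have := koszulSign_swap (A := A) h.2.1 h.2.2 h.1
    convert zero_smul A _
    linear_combination x j * x k * this
  · rintro ⟨j, k⟩ h _ he
    simp only [Finset.mem_sigma, Finset.mem_erase] at h
    simp only [Sigma.mk.injEq, heq_eq_eq] at he
    exact h.2.1 he.1
  · rintro ⟨j, k⟩ h
    simp only [Finset.mem_sigma, Finset.mem_erase] at h ⊢
    exact ⟨h.2.2, h.2.1.symm, h.1⟩
  · intros; rfl

lemma koszulDiff_homotopy (x : Fin n → A) (j : Fin n) (G : Finset (Fin n) → M) :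
    koszulDiff x (koszulHomotopy A j G) + koszulHomotopy A j (koszulDiff x G) = x j • G := by
  funext t
  by_cases hj : j ∈ t
  · have : koszulHomotopy A j (koszulDiff x G) t = 0 := if_pos hj
    rw [Pi.add_apply, this, add_zero, koszulDiff, Finset.sum_eq_single_of_mem j hj]
    · rw [koszulHomotopy, if_neg (Finset.notMem_erase j t), koszulSign_erase_of_le le_rfl,
        Finset.insert_erase hj, smul_smul, mul_right_comm, koszulSign_mul_self, one_mul]
      rfl
    · intro k _ hk
      rw [koszulHomotopy, if_pos (Finset.mem_erase.2 ⟨hk.symm, hj⟩), smul_zero]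
  · have hs : koszulSign A (insert j t) j = koszulSign A t j := by
      rw [← koszulSign_erase_of_le le_rfl (insert j t), Finset.erase_insert hj]
    simp only [Pi.add_apply, koszulHomotopy, if_neg hj, koszulDiff, Finset.sum_insert hj,
      Finset.erase_insert hj, smul_add, smul_smul, hs, Finset.smul_sum, Pi.smul_apply]
    rw [← mul_assoc, koszulSign_mul_self, one_mul, add_left_comm, ← Finset.sum_add_distrib,
      Finset.sum_eq_zero, add_zero]
    intro k hk
    have hkj : k ≠ j := fun h => hj (h ▸ hk)
    rw [if_neg (fun h => hj (Finset.mem_of_mem_erase h)), smul_smul,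
      ← Finset.erase_insert_of_ne hkj.symm, ← add_smul]
    have h2 : koszulSign A ((insert j t).erase k) j = koszulSign A (t.erase k) j := by
      rw [Finset.erase_insert_of_ne hkj.symm,
        ← koszulSign_erase_of_le le_rfl (insert j (t.erase k)), Finset.erase_insert
        (fun h => hj (Finset.mem_of_mem_erase h))]
    have h1 := koszulSign_swap (A := A) hkj.symm (Finset.mem_insert_self j t)
      (Finset.mem_insert_of_mem hk)
    rw [h2, Finset.erase_insert hj, hs] at h1
    have h3 := koszulSign_mul_self (A := A) t k
    have h4 := koszulSign_mul_self (A := A) (insert j t) k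
    convert zero_smul A _
    have : koszulSign A t k * koszulSign A (t.erase k) j
        = -(koszulSign A t j * koszulSign A (insert j t) k) := by
      linear_combination (koszulSign A (insert j t) k * koszulSign A t k) * h1 +
        (- koszulSign A t k * koszulSign A (t.erase k) j) * h4 -
        (koszulSign A (insert j t) k * koszulSign A t j) * h3
    linear_combination x k * this

/-- Vanishing of the degree `i` Koszul cohomology, in terms of the total differential. -/
def KoszulExactAt (M : Type*) [AddCommGroup M] [Module A M] (x : Fin n → A) (i : ℕ) : Prop :=
  ∀ G : Finset (Fin n) → M, (∀ s, s.card ≠ i → G s = 0) → koszulDiff x G = 0 →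
    ∃ U : Finset (Fin n) → M, (∀ s, s.card + 1 ≠ i → U s = 0) ∧ koszulDiff x U = G

lemma koszulDiff_add (x : Fin n → A) (G H : Finset (Fin n) → M) :
    koszulDiff x (G + H) = koszulDiff x G + koszulDiff x H := by
  funext t
  simp [koszulDiff, Finset.sum_add_distrib]

lemma koszulDiff_smul (x : Fin n → A) (a : A) (G : Finset (Fin n) → M) :
    koszulDiff x (a • G) = a • koszulDiff x G := by
  funext t
  simp only [koszulDiff, Pi.smul_apply, Finset.smul_sum]
  exact Finset.sum_congr rfl fun j _ => smul_comm _ _ _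

lemma koszulDiff_sub (x : Fin n → A) (G H : Finset (Fin n) → M) :
    koszulDiff x (G - H) = koszulDiff x G - koszulDiff x H := by
  funext t
  simp [koszulDiff, smul_sub]

lemma koszulDiff_zero (x : Fin n → A) : koszulDiff x (0 : Finset (Fin n) → M) = 0 := by
  funext t
  simp [koszulDiff]

lemma koszulDiff_map {N : Type*} [AddCommGroup N] [Module A N] (φ : M →ₗ[A] N)
    (x : Fin n → A) (G : Finset (Fin n) → M) :
    koszulDiff x (φ ∘ G) = φ ∘ koszulDiff x G := by
  funext t
  simp [koszulDiff]

lemma koszulDiff_eq_zero_of_card {x : Fin n → A} {G : Finset (Fin n) → M} {i : ℕ}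
    (h : ∀ s, s.card + 1 ≠ i → G s = 0) {t : Finset (Fin n)} (ht : t.card ≠ i) :
    koszulDiff x G t = 0 :=
  Finset.sum_eq_zero fun j hj => by
    rw [h, smul_zero]
    rwa [Finset.card_erase_add_one hj]

/-- Extension by zero of a Koszul cochain of degree `i`. -/
def koszulExtend (i : ℕ) (g : {s : Finset (Fin n) // s.card = i} → M) (s : Finset (Fin n)) : M :=
  if h : s.card = i then g ⟨s, h⟩ else 0

lemma koszulExtend_of_card_ne {i : ℕ} (g : {s : Finset (Fin n) // s.card = i} → M)
    {s : Finset (Fin n)} (h : s.card ≠ i) : koszulExtend i g s = 0 := dif_neg h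

lemma koszulExtend_restrict {i : ℕ} {G : Finset (Fin n) → M}
    (h : ∀ s, s.card ≠ i → G s = 0) :
    koszulExtend i (fun s => G s.1) = G := by
  funext s
  by_cases hs : s.card = i
  · exact dif_pos hs
  · rw [koszulExtend_of_card_ne _ hs, h s hs]

lemma koszulMap_apply (x : Fin n → A) (i : ℕ) (g : {s : Finset (Fin n) // s.card = i} → M)
    (t : {s : Finset (Fin n) // s.card = i + 1}) :
    koszulMap A M x i g t = koszulDiff x (koszulExtend i g) t.1 := by
  simp only [koszulMap, LinearMap.coe_mk, AddHom.coe_mk]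
  rw [koszulDiff, ← Finset.sum_attach t.1]
  refine Finset.sum_congr rfl fun j _ => ?_
  rw [koszulExtend, dif_pos (by rw [Finset.card_erase_of_mem j.2, t.2]; rfl)]
  rfl

lemma koszulMap_eq_iff (x : Fin n → A) (i : ℕ) (g : {s : Finset (Fin n) // s.card = i} → M)
    (h : {s : Finset (Fin n) // s.card = i + 1} → M) :
    koszulMap A M x i g = h ↔ koszulDiff x (koszulExtend i g) = koszulExtend (i + 1) h := by
  constructor
  · rintro rfl
    funext t
    by_cases ht : t.card = i + 1
    · rw [koszulExtend, dif_pos ht, koszulMap_apply]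
    · rw [koszulExtend_of_card_ne _ ht]
      exact koszulDiff_eq_zero_of_card
        (fun s hs => koszulExtend_of_card_ne g fun h => hs (h ▸ rfl)) ht
  · intro H
    funext t
    rw [koszulMap_apply, H, koszulExtend, dif_pos t.2]

lemma koszulExtend_zero (i : ℕ) :
    koszulExtend i (0 : {s : Finset (Fin n) // s.card = i} → M) = 0 := by
  funext s
  simp [koszulExtend]

lemma koszulMap_eq_zero_iff (x : Fin n → A) (i : ℕ)
    (g : {s : Finset (Fin n) // s.card = i} → M) :
    koszulMap A M x i g = 0 ↔ koszulDiff x (koszulExtend i g) = 0 := by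
  rw [koszulMap_eq_iff, koszulExtend_zero]

lemma koszulCohomologyNeZero_iff (x : Fin n → A) (i : ℕ) :
    koszulCohomologyNeZero A M x i ↔ ¬ KoszulExactAt M x i := by
  cases i with
  | zero =>
    refine not_congr ((Submodule.eq_bot_iff _).trans ⟨fun h G hG hd => ?_, fun h g hg => ?_⟩)
    · refine ⟨0, fun _ _ => rfl, ?_⟩
      have := h (fun s => G s.1) (by
        rw [LinearMap.mem_ker, koszulMap_eq_zero_iff, koszulExtend_restrict hG, hd])
      rw [koszulDiff_zero, ← koszulExtend_restrict hG, this, koszulExtend_zero]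
    · rw [LinearMap.mem_ker, koszulMap_eq_zero_iff] at hg
      obtain ⟨U, hU, e⟩ := h _ (fun s hs => koszulExtend_of_card_ne g hs) hg
      have hU0 : U = 0 := funext fun s => hU s (Nat.succ_ne_zero _)
      rw [hU0, koszulDiff_zero] at e
      funext s
      have := congrFun e s.1
      rw [koszulExtend, dif_pos s.2] at this
      exact this.symm
  | succ i =>
    refine not_congr ⟨fun h G hG hd => ?_, fun h g hg => ?_⟩
    · obtain ⟨u, hu⟩ := h (x := fun s => G s.1) (by
        rw [LinearMap.mem_ker, koszulMap_eq_zero_iff, koszulExtend_restrict hG, hd])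
      rw [koszulMap_eq_iff, koszulExtend_restrict hG] at hu
      exact ⟨_, fun s hs => koszulExtend_of_card_ne u fun h => hs (h ▸ rfl), hu⟩
    · rw [LinearMap.mem_ker, koszulMap_eq_zero_iff] at hg
      obtain ⟨U, hU, e⟩ := h _ (fun s hs => koszulExtend_of_card_ne g hs) hg
      refine ⟨fun s => U s.1, ?_⟩
      rw [koszulMap_eq_iff, koszulExtend_restrict (fun s hs => hU s fun h => hs (by omega)), e]

lemma le_kgrSeq_iff (x : Fin n → A) (k : ℕ) :
    (k : ℕ∞) ≤ kgrSeq A M x ↔ ∀ i < k, KoszulExactAt M x i := by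
  simp only [kgrSeq, le_sInf_iff, Set.mem_ofPred_eq, koszulCohomologyNeZero_iff]
  constructor
  · intro h i hi
    by_contra hc
    exact absurd (h i ⟨i, rfl, hc⟩) (by simpa using hi)
  · rintro h _ ⟨i, rfl, hc⟩
    by_contra hlt
    exact hc (h i (by simpa using hlt))

lemma exists_koszulDiff_eq_smul {x : Fin n → A} {r : A} (hr : r ∈ Ideal.span (Set.range x))
    {i : ℕ} {G : Finset (Fin n) → M} (hG : ∀ s, s.card ≠ i → G s = 0)
    (hd : koszulDiff x G = 0) :
    ∃ U : Finset (Fin n) → M, (∀ s, s.card + 1 ≠ i → U s = 0) ∧ koszulDiff x U = r • G := by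
  induction hr using Submodule.span_induction with
  | mem r hr =>
    obtain ⟨j, rfl⟩ := hr
    refine ⟨koszulHomotopy A j G, fun s hs => ?_, ?_⟩
    · by_cases hj : j ∈ s
      · exact if_pos hj
      · rw [koszulHomotopy, if_neg hj, hG _ (by rwa [Finset.card_insert_of_notMem hj]), smul_zero]
    · rw [← koszulDiff_homotopy, hd]
      have : koszulHomotopy A j (0 : Finset (Fin n) → M) = 0 := by
        funext t; simp [koszulHomotopy]
      rw [this, add_zero]
  | zero => exact ⟨0, fun _ _ => rfl, by rw [koszulDiff_zero, zero_smul]⟩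
  | add r s _ _ h1 h2 =>
    obtain ⟨U, hU, eU⟩ := h1
    obtain ⟨V, hV, eV⟩ := h2
    exact ⟨U + V, fun s hs => by rw [Pi.add_apply, hU s hs, hV s hs, add_zero],
      by rw [koszulDiff_add, eU, eV, add_smul]⟩
  | smul a r _ h1 =>
    obtain ⟨U, hU, eU⟩ := h1
    exact ⟨a • U, fun s hs => by rw [Pi.smul_apply, hU s hs, smul_zero],
      by rw [koszulDiff_smul, eU, smul_assoc]⟩

lemma koszulExactAt_zero_iff (x : Fin n → A) :
    KoszulExactAt M x 0 ↔ ∀ m : M, (∀ r ∈ Ideal.span (Set.range x), r • m = 0) → m = 0 := by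
  constructor
  · intro h m hm
    obtain ⟨U, hU, e⟩ := h (fun s => if s = ∅ then m else 0)
      (fun s hs => if_neg fun h => hs (by simp [h])) (by
        funext t
        refine Finset.sum_eq_zero fun j _ => ?_
        dsimp only
        split_ifs
        · exact hm _ (Ideal.mul_mem_left _ _ (Ideal.subset_span ⟨j, rfl⟩))
        · exact smul_zero _)
    have hU0 : U = 0 := funext fun s => hU s (Nat.succ_ne_zero _)
    rw [hU0, koszulDiff_zero] at e
    simpa using (congrFun e ∅).symm
  · intro h G hG hd
    refine ⟨0, fun _ _ => rfl, ?_⟩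
    rw [koszulDiff_zero]
    funext s
    refine (h _ fun r hr => ?_).symm
    obtain ⟨U, hU, e⟩ := exists_koszulDiff_eq_smul hr hG hd
    have hU0 : U = 0 := funext fun s => hU s (Nat.succ_ne_zero _)
    rw [hU0, koszulDiff_zero] at e
    exact (congrFun e s).symm

section Shift

variable {N : Type*} [AddCommGroup N] [Module A N] {x : Fin n → A} {r : A} {π : M →ₗ[A] N}

lemma exists_lift_cochain (hπ : Function.Surjective π) {i : ℕ} {G : Finset (Fin n) → N}
    (hG : ∀ s, s.card ≠ i → G s = 0) :
    ∃ H : Finset (Fin n) → M, (∀ s, s.card ≠ i → H s = 0) ∧ π ∘ H = G := by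
  choose σ hσ using hπ
  refine ⟨fun s => if s.card = i then σ (G s) else 0, fun s hs => if_neg hs, ?_⟩
  funext s
  by_cases hs : s.card = i
  · simp [hs, hσ]
  · simp [hs, hG s hs]

lemma exists_eq_smul_cochain (hker : LinearMap.ker π ≤ LinearMap.range (LinearMap.lsmul A M r))
    {i : ℕ} {G : Finset (Fin n) → M} (hG : ∀ s, s.card ≠ i → G s = 0) (h : π ∘ G = 0) :
    ∃ H : Finset (Fin n) → M, (∀ s, s.card ≠ i → H s = 0) ∧ r • H = G := by
  have (s : Finset (Fin n)) : ∃ m : M, r • m = G s := hker (congrFun h s)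
  choose H hH using this
  refine ⟨fun s => if s.card = i then H s else 0, fun s hs => if_neg hs, ?_⟩
  funext s
  by_cases hs : s.card = i
  · simp [hs, hH]
  · simp [hs, hG s hs]

lemma KoszulExactAt.quotient (hreg : IsSMulRegular M r) (hπ : Function.Surjective π)
    (hker : LinearMap.ker π = LinearMap.range (LinearMap.lsmul A M r)) {i : ℕ}
    (h₀ : KoszulExactAt M x i) (h₁ : KoszulExactAt M x (i + 1)) : KoszulExactAt N x i := by
  have hπr (m : M) : π (r • m) = 0 :=
    hker.ge ⟨m, rfl⟩
  intro G hG hd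
  obtain ⟨Z, hZ, rfl⟩ := exists_lift_cochain hπ hG
  rw [koszulDiff_map] at hd
  obtain ⟨W, hW, eW⟩ := exists_eq_smul_cochain hker.le
    (G := koszulDiff x Z) (fun s hs => koszulDiff_eq_zero_of_card (i := i + 1) (x := x)
      (fun s hs => hZ s fun h => hs (by rw [h])) hs) hd
  have hdW : koszulDiff x W = 0 := by
    have := koszulDiff_koszulDiff x Z
    rw [← eW, koszulDiff_smul] at this
    exact funext fun s => hreg (by simpa using congrFun this s)
  obtain ⟨U, hU, eU⟩ := h₁ W hW hdW
  obtain ⟨V, hV, eV⟩ := h₀ (Z - r • U) (fun s hs => by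
      rw [Pi.sub_apply, Pi.smul_apply, hZ s hs, hU s fun h => hs (by omega)]; simp) (by
      rw [koszulDiff_sub, koszulDiff_smul, eU, eW, sub_self])
  refine ⟨π ∘ V, fun s hs => by rw [Function.comp_apply, hV s hs, map_zero], ?_⟩
  rw [koszulDiff_map, eV]
  funext s
  simp [-map_smul, hπr]

lemma KoszulExactAt.of_quotient (hr : r ∈ Ideal.span (Set.range x)) (hreg : IsSMulRegular M r)
    (hπ : Function.Surjective π)
    (hker : LinearMap.ker π = LinearMap.range (LinearMap.lsmul A M r)) {i : ℕ}
    (h : KoszulExactAt N x i) : KoszulExactAt M x (i + 1) := by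
  have hπr (m : M) : π (r • m) = 0 :=
    hker.ge ⟨m, rfl⟩
  intro W hW hd
  obtain ⟨Z, hZ, eZ⟩ := exists_koszulDiff_eq_smul hr hW hd
  have hZ' : ∀ s, s.card ≠ i → Z s = 0 := fun s hs => hZ s fun h => hs (by omega)
  obtain ⟨V', hV', eV'⟩ := h (π ∘ Z)
    (fun s hs => by rw [Function.comp_apply, hZ' s hs, map_zero]) (by
      rw [koszulDiff_map, eZ]; funext s; simpa [-map_smul] using hπr _)
  obtain ⟨V, hV, eV⟩ : ∃ V : Finset (Fin n) → M, (∀ s, s.card + 1 ≠ i → V s = 0) ∧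
      π ∘ V = V' := by
    cases i with
    | zero =>
      refine ⟨0, fun _ _ => rfl, funext fun s => ?_⟩
      simp [hV' s (Nat.succ_ne_zero _)]
    | succ i =>
      obtain ⟨V, hV, eV⟩ := exists_lift_cochain (i := i) hπ (G := V')
        fun s hs => hV' s fun h => hs (by omega)
      exact ⟨V, fun s hs => hV s fun h => hs (by omega), eV⟩
  obtain ⟨U, hU, eU⟩ := exists_eq_smul_cochain (i := i) hker.le (G := Z - koszulDiff x V)
    (fun s hs => by
      rw [Pi.sub_apply, hZ' s hs, koszulDiff_eq_zero_of_card hV hs, sub_zero]) (by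
    funext s
    have := congrFun eV' s
    rw [← eV, koszulDiff_map] at this
    simpa [sub_eq_zero] using this.symm)
  refine ⟨U, fun s hs => hU s fun h => hs (by omega), ?_⟩
  have h1 : r • koszulDiff x U = r • W := by
    rw [← koszulDiff_smul, eU, koszulDiff_sub, koszulDiff_koszulDiff, sub_zero, eZ]
  exact funext fun s => hreg (by simpa using congrFun h1 s)

/-- Passing to the quotient by a regular element of the ideal lowers the Koszul grade by one. -/
lemma succ_le_kgrSeq_iff (hr : r ∈ Ideal.span (Set.range x)) (hreg : IsSMulRegular M r)
    (hπ : Function.Surjective π)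
    (hker : LinearMap.ker π = LinearMap.range (LinearMap.lsmul A M r)) (k : ℕ) :
    ((k + 1 : ℕ) : ℕ∞) ≤ kgrSeq A M x ↔ (k : ℕ∞) ≤ kgrSeq A N x := by
  rw [le_kgrSeq_iff, le_kgrSeq_iff]
  constructor
  · intro h i hi
    exact (h i (by omega)).quotient hreg hπ hker (h (i + 1) (by omega))
  · intro h i hi
    cases i with
    | zero =>
      exact (koszulExactAt_zero_iff x).2 fun m hm => hreg.right_eq_zero_of_smul (hm r hr)
    | succ i => exact (h i (by omega)).of_quotient hr hreg hπ hker

end Shift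

lemma kgrSeq_prod {N : Type*} [AddCommGroup N] [Module A N] (x : Fin n → A) (k : ℕ) :
    (k : ℕ∞) ≤ kgrSeq A (M × N) x ↔ (k : ℕ∞) ≤ kgrSeq A M x ∧ (k : ℕ∞) ≤ kgrSeq A N x := by
  simp only [le_kgrSeq_iff, ← forall_and]
  refine forall₂_congr fun i _ => ⟨fun h => ⟨fun G hG hd => ?_, fun G hG hd => ?_⟩,
    fun ⟨h₁, h₂⟩ G hG hd => ?_⟩
  · obtain ⟨U, hU, e⟩ := h (LinearMap.inl A M N ∘ G)
      (fun s hs => by rw [Function.comp_apply, hG s hs, map_zero])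
      (by rw [koszulDiff_map, hd]; funext s; simp)
    refine ⟨LinearMap.fst A M N ∘ U, fun s hs => by rw [Function.comp_apply, hU s hs, map_zero],
      ?_⟩
    rw [koszulDiff_map, e]
    rfl
  · obtain ⟨U, hU, e⟩ := h (LinearMap.inr A M N ∘ G)
      (fun s hs => by rw [Function.comp_apply, hG s hs, map_zero])
      (by rw [koszulDiff_map, hd]; funext s; simp)
    refine ⟨LinearMap.snd A M N ∘ U, fun s hs => by rw [Function.comp_apply, hU s hs, map_zero],
      ?_⟩
    rw [koszulDiff_map, e]
    rfl
  · obtain ⟨U, hU, eU⟩ := h₁ (LinearMap.fst A M N ∘ G)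
      (fun s hs => by rw [Function.comp_apply, hG s hs, map_zero])
      (by rw [koszulDiff_map, hd]; funext s; simp)
    obtain ⟨V, hV, eV⟩ := h₂ (LinearMap.snd A M N ∘ G)
      (fun s hs => by rw [Function.comp_apply, hG s hs, map_zero])
      (by rw [koszulDiff_map, hd]; funext s; simp)
    refine ⟨fun s => (U s, V s), fun s hs => Prod.ext (hU s hs) (hV s hs), ?_⟩
    funext s
    refine Prod.ext ?_ ?_
    · have := congrFun (koszulDiff_map (LinearMap.fst A M N) x fun s => (U s, V s)) s
      exact this.symm.trans (congrFun eU s)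
    · have := congrFun (koszulDiff_map (LinearMap.snd A M N) x fun s => (U s, V s)) s
      exact this.symm.trans (congrFun eV s)

lemma le_kgrSeq_congr {R : Type*} [CommRing R] {N : Type*} [AddCommGroup N] [Module R N]
    (φ : A →+* R) (e : M ≃+ N) (he : ∀ (a : A) (m : M), e (a • m) = φ a • e m)
    (x : Fin n → A) (k : ℕ) :
    (k : ℕ∞) ≤ kgrSeq R N (φ ∘ x) ↔ (k : ℕ∞) ≤ kgrSeq A M x := by
  have hd (G : Finset (Fin n) → M) : koszulDiff (φ ∘ x) (e ∘ G) = e ∘ koszulDiff x G := by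
    funext t
    simp [koszulDiff, koszulSign, he]
  simp only [le_kgrSeq_iff]
  refine forall₂_congr fun i _ => ⟨fun h G hG hG0 => ?_, fun h G hG hG0 => ?_⟩
  · obtain ⟨U, hU, hUG⟩ := h (e ∘ G)
      (fun s hs => by rw [Function.comp_apply, hG s hs, map_zero])
      (by rw [hd, hG0]; funext s; simp)
    refine ⟨e.symm ∘ U, fun s hs => by rw [Function.comp_apply, hU s hs, map_zero],
      e.injective.comp_left ?_⟩
    have : e ∘ e.symm ∘ U = U := funext fun s => e.apply_symm_apply _
    change e ∘ _ = e ∘ _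
    rw [← hd, this, hUG]
  · have hee (H : Finset (Fin n) → N) : e ∘ e.symm ∘ H = H :=
      funext fun s => e.apply_symm_apply _
    obtain ⟨U, hU, hUG⟩ := h (e.symm ∘ G)
      (fun s hs => by rw [Function.comp_apply, hG s hs, map_zero])
      (e.injective.comp_left (by
        change e ∘ _ = e ∘ _
        rw [← hd, hee, hG0]; funext s; simp))
    exact ⟨e ∘ U, fun s hs => by rw [Function.comp_apply, hU s hs, map_zero],
      by rw [hd, hUG, hee]⟩

end Koszul

section Noetherian

open scoped Pointwise

variable {A : Type*} [CommRing A] {M : Type*} [AddCommGroup M] [Module A M]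

lemma ker_mkQ_smul_top (r : A) :
    LinearMap.ker (r • ⊤ : Submodule A M).mkQ = LinearMap.range (LinearMap.lsmul A M r) := by
  rw [Submodule.ker_mkQ]
  ext m
  simp [Submodule.mem_smul_pointwise_iff_exists]

lemma exists_isSMulRegular_of_forall [IsNoetherianRing A] [Module.Finite A M] {𝔞 : Ideal A}
    (h : ∀ m : M, (∀ r ∈ 𝔞, r • m = 0) → m = 0) : ∃ r ∈ 𝔞, IsSMulRegular M r := by
  have : Subsingleton ((A ⧸ 𝔞) →ₗ[A] M) := by
    refine subsingleton_of_forall_eq 0 fun φ => LinearMap.ext fun y => h _ fun r hr => ?_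
    obtain ⟨a, rfl⟩ := Ideal.Quotient.mk_surjective y
    rw [← map_smul, ← Ideal.Quotient.mk_eq_mk, ← Submodule.Quotient.mk_smul, smul_eq_mul,
      (Submodule.Quotient.mk_eq_zero 𝔞).2 (Ideal.mul_mem_right a 𝔞 hr), map_zero]
  obtain ⟨r, hr, hreg⟩ := IsSMulRegular.subsingleton_linearMap_iff.1 this
  exact ⟨r, by rwa [Ideal.annihilator_quotient] at hr, hreg⟩

lemma exists_isSMulRegular_of_le_kgrSeq [IsNoetherianRing A] [Module.Finite A M] {n : ℕ}
    {x : Fin n → A} {k : ℕ} (h : ((k + 1 : ℕ) : ℕ∞) ≤ kgrSeq A M x) :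
    ∃ r ∈ Ideal.span (Set.range x), IsSMulRegular M r :=
  exists_isSMulRegular_of_forall ((koszulExactAt_zero_iff x).1
    ((le_kgrSeq_iff x _).1 h 0 k.succ_pos))

/-- The Koszul grade on a finite module over a Noetherian ring only depends on the sequence
through the radical of the ideal it generates. -/
lemma le_kgrSeq_of_span_le_radical {A : Type*} [CommRing A] [IsNoetherianRing A] (k : ℕ) :
    ∀ {M : Type*} [AddCommGroup M] [Module A M] [Module.Finite A M] {n n' : ℕ}
      {x : Fin n → A} {y : Fin n' → A}
      (_ : Ideal.span (Set.range x) ≤ (Ideal.span (Set.range y)).radical)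
      (_ : (k : ℕ∞) ≤ kgrSeq A M x), (k : ℕ∞) ≤ kgrSeq A M y := by
  induction k with
  | zero => intros; simp
  | succ k ih =>
    intro M _ _ _ n n' x y hxy h
    obtain ⟨r, hr, hreg⟩ := exists_isSMulRegular_of_le_kgrSeq h
    obtain ⟨e, he⟩ := hxy hr
    have hr' : r ^ (e + 1) ∈ Ideal.span (Set.range x) := Ideal.pow_mem_of_mem _ hr _ e.succ_pos
    have he' : r ^ (e + 1) ∈ Ideal.span (Set.range y) := Ideal.pow_mem_of_pow_mem _ he (by omega)
    have hs := Submodule.mkQ_surjective (r ^ (e + 1) • ⊤ : Submodule A M)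
    have hk := ker_mkQ_smul_top (M := M) (r ^ (e + 1))
    rw [succ_le_kgrSeq_iff he' (hreg.pow _) hs hk]
    rw [succ_le_kgrSeq_iff hr' (hreg.pow _) hs hk] at h
    exact ih hxy h

lemma exists_span_range_eq [IsNoetherianRing A] (𝔞 : Ideal A) :
    ∃ (n : ℕ) (x : Fin n → A), Ideal.span (Set.range x) = 𝔞 :=
  Submodule.fg_iff_exists_fin_generating_family.1 (IsNoetherian.noetherian 𝔞)

lemma natCast_le_kgr_iff {𝔞 : Ideal A} {k : ℕ} :
    (k : ℕ∞) ≤ kgr A 𝔞 M ↔ ∃ (n : ℕ) (x : Fin n → A), (∀ j, x j ∈ 𝔞) ∧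
      (k : ℕ∞) ≤ kgrSeq A M x := by
  constructor
  · cases k with
    | zero => exact fun _ => ⟨0, Fin.elim0, fun j => j.elim0, by simp⟩
    | succ k =>
      intro h
      rw [Nat.cast_add, Nat.cast_one, ENat.add_one_le_iff (ENat.natCast_ne_top k), kgr] at h
      simp only [lt_iSup_iff] at h
      obtain ⟨n, x, hx, h⟩ := h
      refine ⟨n, x, hx, ?_⟩
      rwa [Nat.cast_add, Nat.cast_one, ENat.add_one_le_iff (ENat.natCast_ne_top k)]
  · rintro ⟨n, x, hx, h⟩
    exact h.trans (le_iSup_of_le n (le_iSup_of_le x (le_iSup_of_le hx le_rfl)))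

lemma le_kgr_iff_le_kgrSeq [IsNoetherianRing A] [Module.Finite A M] {𝔞 : Ideal A} {n : ℕ}
    {x : Fin n → A} (hx : (Ideal.span (Set.range x)).radical = 𝔞.radical) (k : ℕ) :
    (k : ℕ∞) ≤ kgr A 𝔞 M ↔ (k : ℕ∞) ≤ kgrSeq A M x := by
  rw [natCast_le_kgr_iff]
  constructor
  · rintro ⟨n', y, hy, h⟩
    refine le_kgrSeq_of_span_le_radical k (Ideal.span_le.2 ?_) h
    rintro _ ⟨j, rfl⟩
    rw [hx]
    exact Ideal.le_radical (hy j)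
  · intro h
    obtain ⟨n', y, rfl⟩ := exists_span_range_eq 𝔞
    exact ⟨n', y, fun j => Ideal.subset_span ⟨j, rfl⟩,
      le_kgrSeq_of_span_le_radical k (Ideal.le_radical.trans hx.le) h⟩

lemma exists_isSMulRegular_of_le_kgr [IsNoetherianRing A] [Module.Finite A M] {𝔞 : Ideal A}
    {k : ℕ} (h : ((k + 1 : ℕ) : ℕ∞) ≤ kgr A 𝔞 M) : ∃ r ∈ 𝔞, IsSMulRegular M r := by
  obtain ⟨n, x, rfl⟩ := exists_span_range_eq 𝔞
  exact exists_isSMulRegular_of_le_kgrSeq ((le_kgr_iff_le_kgrSeq rfl _).1 h)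

lemma succ_le_kgr_iff [IsNoetherianRing A] [Module.Finite A M] {N : Type*} [AddCommGroup N]
    [Module A N] [Module.Finite A N] {π : M →ₗ[A] N} {𝔞 : Ideal A} {r : A}
    (hr : r ∈ 𝔞) (hreg : IsSMulRegular M r) (hπ : Function.Surjective π)
    (hker : LinearMap.ker π = LinearMap.range (LinearMap.lsmul A M r)) (k : ℕ) :
    ((k + 1 : ℕ) : ℕ∞) ≤ kgr A 𝔞 M ↔ (k : ℕ∞) ≤ kgr A 𝔞 N := by
  obtain ⟨n, x, rfl⟩ := exists_span_range_eq 𝔞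
  rw [le_kgr_iff_le_kgrSeq rfl, le_kgr_iff_le_kgrSeq rfl, succ_le_kgrSeq_iff hr hreg hπ hker]

lemma kgr_mono {𝔞 𝔟 : Ideal A} (h : 𝔞 ≤ 𝔟) : kgr A 𝔞 M ≤ kgr A 𝔟 M :=
  iSup_mono fun _ => iSup_mono fun _ => iSup_mono' fun hx => ⟨fun j => h (hx j), le_rfl⟩

lemma le_supportDim_of_le_kgr {A : Type*} [CommRing A] [IsNoetherianRing A] [IsLocalRing A]
    (k : ℕ) : ∀ {M : Type*} [AddCommGroup M] [Module A M] [Module.Finite A M] [Nontrivial M]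
      (_ : (k : ℕ∞) ≤ kgr A (IsLocalRing.maximalIdeal A) M),
      (k : WithBot ℕ∞) ≤ Module.supportDim A M := by
  induction k with
  | zero =>
    intro M _ _ _ _ _
    obtain ⟨d, hd⟩ := WithBot.ne_bot_iff_exists.1 (Module.supportDim_ne_bot_of_nontrivial A M)
    rw [← hd]
    exact WithBot.coe_le_coe.2 zero_le
  | succ k ih =>
    intro M _ _ _ _ h
    obtain ⟨r, hr, hreg⟩ := exists_isSMulRegular_of_le_kgr h
    rw [succ_le_kgr_iff hr hreg (Submodule.mkQ_surjective _) (ker_mkQ_smul_top r)] at h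
    have : Nontrivial (QuotSMulTop r M) := by
      rw [Submodule.Quotient.nontrivial_iff]
      exact (Submodule.top_ne_pointwise_smul_of_mem_jacobson_annihilator
        (IsLocalRing.maximalIdeal_le_jacobson _ hr)).symm
    rw [← Module.supportDim_quotSMulTop_succ_eq_supportDim hreg hr]
    push_cast
    gcongr
    exact ih h

/-- The depth of a nonzero finite module over a Noetherian local ring is at most the dimension
of the ring. -/
lemma kgr_maximalIdeal_le_ringKrullDim [IsNoetherianRing A] [IsLocalRing A] [Module.Finite A M]
    [Nontrivial M] :
    (kgr A (IsLocalRing.maximalIdeal A) M : WithBot ℕ∞) ≤ ringKrullDim A := by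
  refine le_trans ?_ (Module.supportDim_le_ringKrullDim A M)
  obtain ⟨d, hd⟩ := WithBot.ne_bot_iff_exists.1 (Module.supportDim_ne_bot_of_nontrivial A M)
  rw [← hd, WithBot.coe_le_coe]
  refine ENat.forall_natCast_le_iff_le.1 fun k hk => ?_
  have := le_supportDim_of_le_kgr k hk
  rw [← hd] at this
  exact WithBot.coe_le_coe.1 this

section Localization

variable {𝔭 : Ideal A} [𝔭.IsPrime]

lemma algebraMap_mem_maximalIdeal {r : A} (hr : r ∈ 𝔭) :
    algebraMap A (Localization.AtPrime 𝔭) r ∈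
      IsLocalRing.maximalIdeal (Localization.AtPrime 𝔭) :=
  (IsLocalization.AtPrime.to_map_mem_maximal_iff _ 𝔭 r).2 hr

variable [IsNoetherianRing A] [Module.Finite A M]

lemma succ_le_kgr_localization_iff {r : A} (hr : r ∈ 𝔭) (hreg : IsSMulRegular M r) (k : ℕ) :
    ((k + 1 : ℕ) : ℕ∞) ≤ kgr (Localization.AtPrime 𝔭)
        (IsLocalRing.maximalIdeal (Localization.AtPrime 𝔭)) (LocalizedModule 𝔭.primeCompl M) ↔
      (k : ℕ∞) ≤ kgr (Localization.AtPrime 𝔭)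
        (IsLocalRing.maximalIdeal (Localization.AtPrime 𝔭))
        (LocalizedModule 𝔭.primeCompl (QuotSMulTop r M)) := by
  refine succ_le_kgr_iff (algebraMap_mem_maximalIdeal hr)
    (IsSMulRegular.of_isLocalizedModule (Localization.AtPrime 𝔭) 𝔭.primeCompl
      (LocalizedModule.mkLinearMap 𝔭.primeCompl M) hreg)
    (π := LocalizedModule.map 𝔭.primeCompl (r • ⊤ : Submodule A M).mkQ)
    (LocalizedModule.map_surjective _ _ (Submodule.mkQ_surjective _)) ?_ k
  have hex : Function.Exact (LinearMap.lsmul A M r) (r • ⊤ : Submodule A M).mkQ :=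
    LinearMap.exact_iff.2 (ker_mkQ_smul_top r)
  have := LocalizedModule.map_exact 𝔭.primeCompl _ _ hex
  ext m
  refine (this m).trans ?_
  have hl (m : LocalizedModule 𝔭.primeCompl M) :
      LocalizedModule.map 𝔭.primeCompl (LinearMap.lsmul A M r) m =
        algebraMap A (Localization.AtPrime 𝔭) r • m := by
    induction m using LocalizedModule.induction_on with
    | h m s =>
      rw [LocalizedModule.map_mk, algebraMap_smul, LocalizedModule.smul'_mk]
      rfl
  exact exists_congr fun y => iff_of_eq (congrArg (· = m) (hl y))

end Localization

/-- Localizing at a prime does not decrease the Koszul grade of that prime. -/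
lemma le_kgr_localization_of_le_kgr [IsNoetherianRing A] (𝔭 : Ideal A) [𝔭.IsPrime] (k : ℕ) :
    ∀ {M : Type*} [AddCommGroup M] [Module A M] [Module.Finite A M] (_ : (k : ℕ∞) ≤ kgr A 𝔭 M),
      (k : ℕ∞) ≤ kgr (Localization.AtPrime 𝔭)
        (IsLocalRing.maximalIdeal (Localization.AtPrime 𝔭))
        (LocalizedModule 𝔭.primeCompl M) := by
  induction k with
  | zero => intros; simp
  | succ k ih =>
    intro M _ _ _ h
    obtain ⟨r, hr, hreg⟩ := exists_isSMulRegular_of_le_kgr h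
    rw [succ_le_kgr_iff hr hreg (Submodule.mkQ_surjective _) (ker_mkQ_smul_top r)] at h
    exact (succ_le_kgr_localization_iff hr hreg k).2 (ih h)

lemma exists_le_mem_support_kgr_eq_zero [IsNoetherianRing A] [Module.Finite A M] {𝔟 : Ideal A}
    {m : M} (hm : m ≠ 0) (h𝔟 : ∀ r ∈ 𝔟, r • m = 0) :
    ∃ p : PrimeSpectrum A, 𝔟 ≤ p.asIdeal ∧ p ∈ Module.support A M ∧
      kgr (Localization.AtPrime p.asIdeal)
        (IsLocalRing.maximalIdeal (Localization.AtPrime p.asIdeal))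
        (LocalizedModule p.asIdeal.primeCompl M) = 0 := by
  obtain ⟨P, hP, hle⟩ := exists_le_isAssociatedPrime_of_isNoetherianRing A m hm
  obtain ⟨hprime, y, hy⟩ := isAssociatedPrime_iff.1 hP
  have hmem (a : A) : a ∈ P ↔ a • y = 0 := by rw [hy, Submodule.mem_colon_singleton]; simp
  have hy0 : LocalizedModule.mk y (1 : P.primeCompl) ≠ 0 := by
    rw [← LocalizedModule.zero_mk 1, Ne, LocalizedModule.mk_eq]
    rintro ⟨u, hu⟩
    refine u.2 ((hmem _).2 ?_)
    simpa [Submonoid.smul_def] using hu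
  refine ⟨⟨P, hprime⟩, fun r hr => hle ?_, ?_, ?_⟩
  · rw [Submodule.mem_colon_singleton]
    simp [h𝔟 r hr]
  · exact Module.mem_support_iff.2 ⟨_, _, hy0⟩
  · by_contra h0
    have h1 : ((0 + 1 : ℕ) : ℕ∞) ≤ kgr (Localization.AtPrime P)
        (IsLocalRing.maximalIdeal (Localization.AtPrime P))
        (LocalizedModule P.primeCompl M) := by
      simpa using Order.one_le_iff_pos.2 (pos_iff_ne_zero.2 h0)
    obtain ⟨s, hs, hreg⟩ := exists_isSMulRegular_of_le_kgr h1
    obtain ⟨a, t, rfl⟩ := IsLocalization.exists_mk'_eq P.primeCompl s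
    rw [IsLocalization.AtPrime.mk'_mem_maximal_iff _ P] at hs
    rw [← Localization.mk_eq_mk'] at hreg
    refine hy0 (hreg ?_)
    refine (LocalizedModule.mk_smul_mk a y t 1).trans ?_
    rw [(hmem a).1 hs, LocalizedModule.zero_mk]
    exact (smul_zero _).symm

/-- The Koszul grade of an ideal is at least the infimum of the depths of the localizations at
the primes containing it. -/
lemma le_kgr_of_forall_le_kgr_localization [IsNoetherianRing A] {𝔟 : Ideal A} (k : ℕ) :
    ∀ {M : Type*} [AddCommGroup M] [Module A M] [Module.Finite A M]
      (_ : ∀ p : PrimeSpectrum A, 𝔟 ≤ p.asIdeal → p ∈ Module.support A M →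
        (k : ℕ∞) ≤ kgr (Localization.AtPrime p.asIdeal)
          (IsLocalRing.maximalIdeal (Localization.AtPrime p.asIdeal))
          (LocalizedModule p.asIdeal.primeCompl M)),
      (k : ℕ∞) ≤ kgr A 𝔟 M := by
  induction k with
  | zero => intros; simp
  | succ k ih =>
    intro M _ _ _ h
    obtain ⟨r, hr, hreg⟩ := exists_isSMulRegular_of_forall (M := M) (𝔞 := 𝔟) fun m h𝔟 => by
      by_contra hm
      obtain ⟨p, hp, hsupp, h0⟩ := exists_le_mem_support_kgr_eq_zero hm h𝔟
      simpa [h0] using h p hp hsupp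
    rw [succ_le_kgr_iff hr hreg (Submodule.mkQ_surjective _) (ker_mkQ_smul_top r)]
    refine ih fun p hp hsupp => ?_
    exact (succ_le_kgr_localization_iff (hp hr) hreg k).1
      (h p hp (Module.support_subset_of_surjective _ (Submodule.mkQ_surjective _) hsupp))

lemma idealHeight_asIdeal (p : PrimeSpectrum A) : idealHeight A p.asIdeal = Order.height p :=
  le_antisymm (iInf₂_le p le_rfl) (le_iInf₂ fun _ hq => Order.height_mono hq)

lemma idealHeight_mono {𝔞 𝔟 : Ideal A} (h : 𝔞 ≤ 𝔟) : idealHeight A 𝔞 ≤ idealHeight A 𝔟 :=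
  le_iInf₂ fun p hp => iInf₂_le p (h.trans hp)

lemma ringKrullDim_localization_eq (p : PrimeSpectrum A) :
    ringKrullDim (Localization.AtPrime p.asIdeal) = idealHeight A p.asIdeal := by
  rw [idealHeight_asIdeal, IsLocalization.AtPrime.ringKrullDim_eq_height p.asIdeal,
    PrimeSpectrum.height_eq_orderHeight]

lemma kgr_localization_le_idealHeight [IsNoetherianRing A] [Module.Finite A M]
    {p : PrimeSpectrum A} (hp : p ∈ Module.support A M) :
    kgr (Localization.AtPrime p.asIdeal)
      (IsLocalRing.maximalIdeal (Localization.AtPrime p.asIdeal))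
      (LocalizedModule p.asIdeal.primeCompl M) ≤ idealHeight A p.asIdeal := by
  have : Nontrivial (LocalizedModule p.asIdeal.primeCompl M) := hp
  rw [← WithBot.coe_le_coe, ← ringKrullDim_localization_eq]
  exact kgr_maximalIdeal_le_ringKrullDim

lemma kgr_self_le_idealHeight [IsNoetherianRing A] (𝔟 : Ideal A) :
    kgr A 𝔟 A ≤ idealHeight A 𝔟 := by
  refine le_iInf₂ fun p hp => ?_
  rw [← idealHeight_asIdeal]
  refine (ENat.forall_natCast_le_iff_le.1 fun k hk => ?_)
  have hsupp : p ∈ Module.support A A := by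
    rw [Module.support_of_algebra, PrimeSpectrum.mem_zeroLocus]
    exact fun a ha => by simp [show a = 0 from ha]
  exact (le_kgr_localization_of_le_kgr p.asIdeal k (hk.trans (kgr_mono hp))).trans
    (kgr_localization_le_idealHeight hsupp)

lemma isCMIdeals_and_forall_localization_iff [IsNoetherianRing A] [Module.Finite A M] :
    (IsCMIdeals A ∧ ∀ p ∈ Module.support A M,
      (kgr (Localization.AtPrime p.asIdeal)
          (IsLocalRing.maximalIdeal (Localization.AtPrime p.asIdeal))
          (LocalizedModule p.asIdeal.primeCompl M) : WithBot ℕ∞) =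
        ringKrullDim (Localization.AtPrime p.asIdeal)) ↔
      ∀ 𝔟 : Ideal A, idealHeight A 𝔟 = min (kgr A 𝔟 A) (kgr A 𝔟 M) := by
  constructor
  · rintro ⟨hA, hM⟩ 𝔟
    rw [← hA 𝔟, eq_comm, min_eq_left_iff]
    refine ENat.forall_natCast_le_iff_le.1 fun k hk => ?_
    refine le_kgr_of_forall_le_kgr_localization k fun p hp hsupp => ?_
    have := hM p hsupp
    rw [ringKrullDim_localization_eq, WithBot.coe_inj] at this
    exact this ▸ hk.trans (idealHeight_mono hp)
  · intro h
    refine ⟨fun 𝔟 => le_antisymm ((h 𝔟).le.trans (min_le_left _ _)) (kgr_self_le_idealHeight 𝔟),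
      fun p hp => ?_⟩
    rw [ringKrullDim_localization_eq, WithBot.coe_inj]
    refine le_antisymm (kgr_localization_le_idealHeight hp)
      (ENat.forall_natCast_le_iff_le.1 fun k hk => ?_)
    exact le_kgr_localization_of_le_kgr p.asIdeal k
      (hk.trans ((h p.asIdeal).le.trans (min_le_right _ _)))

lemma idealHeight_map {R : Type*} [CommRing R] {π : R →+* A} (hπ : Function.Surjective π)
    (hker : RingHom.ker π ≤ nilradical R) (𝔞 : Ideal R) :
    idealHeight A (𝔞.map π) = idealHeight R 𝔞 := by
  have hbij : Function.Bijective (PrimeSpectrum.comap π) :=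
    (PrimeSpectrum.isHomeomorph_comap π (fun a => ⟨1, one_pos, by simpa using hπ a⟩)
      hker).bijective
  let φ : PrimeSpectrum A ≃o PrimeSpectrum R :=
    ⟨Equiv.ofBijective _ hbij, Ideal.comap_le_comap_iff_of_surjective π hπ _ _⟩
  refine le_antisymm (le_iInf₂ fun q hq => ?_) (le_iInf₂ fun p hp => ?_)
  · obtain ⟨p, rfl⟩ := φ.surjective q
    exact (iInf₂_le p (Ideal.map_le_iff_le_comap.2 hq)).trans (Order.height_orderIso φ p).ge
  · exact (iInf₂_le (φ p) (Ideal.map_le_iff_le_comap.1 hp)).trans (Order.height_orderIso φ p).le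

/-- The Cohen-Macaulay property of a ring `R` that is additively the direct sum of a Noetherian
subring `A` and an ideal of nilpotent elements `M` finite over `A`. -/
lemma isCMIdeals_iff_of_addEquiv [IsNoetherianRing A] [Module.Finite A M] {R : Type*}
    [CommRing R] {ι : A →+* R} {π : R →+* A} (hπι : ∀ a, π (ι a) = a)
    (hker : RingHom.ker π ≤ nilradical R) (e : A × M ≃+ R)
    (he : ∀ a z, e (a • z) = ι a * e z) :
    IsCMIdeals R ↔ ∀ 𝔟 : Ideal A, idealHeight A 𝔟 = min (kgr A 𝔟 A) (kgr A 𝔟 M) := by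
  have hπ : Function.Surjective π := fun a => ⟨ι a, hπι a⟩
  have : IsNoetherianRing R := by
    algebraize [ι]
    have : Module.Finite A R := Module.Finite.equiv
      (AddEquiv.toLinearEquiv e fun a z => by rw [he, Algebra.smul_def]; rfl)
    exact IsNoetherianRing.of_finite A R
  have hrad (𝔞 : Ideal R) : ((𝔞.map π).comap π).radical = 𝔞.radical := by
    refine le_antisymm ?_ (Ideal.radical_mono Ideal.le_comap_map)
    rw [Ideal.comap_map_of_surjective' π hπ, Ideal.radical_le_radical_iff]
    exact sup_le Ideal.le_radical (hker.trans (Ideal.radical_mono bot_le))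
  have hkgr (𝔞 : Ideal R) :
      kgr R 𝔞 R = min (kgr A (𝔞.map π) A) (kgr A (𝔞.map π) M) := by
    obtain ⟨n, x, hx⟩ := exists_span_range_eq (𝔞.map π)
    have hmap : (Ideal.span (Set.range (ι ∘ x))).map π = 𝔞.map π := by
      rw [Ideal.map_span, ← Set.range_comp, ← hx]
      congr 2
      exact funext fun j => hπι (x j)
    refine ENat.eq_of_forall_natCast_le_iff fun k => ?_
    rw [le_kgr_iff_le_kgrSeq (x := ι ∘ x) (by rw [← hrad, hmap, hrad]), le_min_iff, ← hx,
      le_kgr_iff_le_kgrSeq rfl, le_kgr_iff_le_kgrSeq rfl, ← kgrSeq_prod,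
      le_kgrSeq_congr ι e fun a z => he a z]
  constructor
  · intro h 𝔟
    rw [← Ideal.map_comap_of_surjective π hπ 𝔟, idealHeight_map hπ hker, ← hkgr, h]
  · intro h 𝔞
    rw [hkgr, ← h, idealHeight_map hπ hker]

end Noetherian

section Amalgamation

variable {A B : Type*} [CommRing A] [CommRing B] (f : A →+* B) (J : Ideal B)

/-- The projection `A ⋈^f J → A`. -/
def amalgFst : amalgamation f J →+* A :=
  (RingHom.fst A B).comp (amalgamation f J).subtype

variable {J} in
lemma ker_amalgFst_le_nilradical (hJ : J ≤ nilradical B) :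
    RingHom.ker (amalgFst f J) ≤ nilradical (amalgamation f J) := by
  rintro ⟨⟨a, b⟩, hb : b - f a ∈ J⟩ (rfl : a = 0)
  obtain ⟨n, hn⟩ := hJ (by simpa using hb)
  exact ⟨n + 1, Subtype.ext (Prod.ext (by simp) (by simp [pow_succ, show b ^ n = 0 from hn]))⟩

/-- The additive decomposition `A × J ≃ A ⋈^f J`, `(a, j) ↦ (a, f a + j)`. -/
def amalgAddEquiv : A × J ≃+ amalgamation f J where
  toFun z := ⟨(z.1, f z.1 + z.2), show f z.1 + z.2 - f z.1 ∈ J by simp⟩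
  invFun w := (w.1.1, ⟨w.1.2 - f w.1.1, w.2⟩)
  left_inv z := by simp
  right_inv w := by simp
  map_add' z w := Subtype.ext (Prod.ext rfl (by simp; abel))

end Amalgamation

/-- Let `A` be Noetherian and `J ⊆ Nil(B)` finitely generated as an
`A`-module. Then `A⋈^f J` is Cohen-Macaulay iff `A` is Cohen-Macaulay and `J_𝔭` is a
maximal Cohen-Macaulay `A_𝔭`-module (i.e. `depth_{A_𝔭} J_𝔭 = dim A_𝔭`) for every prime
`𝔭 ∈ Supp_A(J)`. (For a Noetherian ring, being Cohen-Macaulay is equivalent to being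
Cohen-Macaulay in the sense of ideals, and depth is given by the Koszul grade of the
maximal ideal.) -/
theorem isCM_amalgamation_iff_of_nil_noetherian {A B : Type*} [CommRing A] [CommRing B]
    [IsNoetherianRing A] (f : A →+* B) (J : Ideal B) (hJ : J ≤ nilradical B)
    (hmod : @Module.Finite A J _ _ (Module.compHom J f)) :
    IsCMIdeals ↥(amalgamation f J) ↔
      IsCMIdeals A ∧
        (letI : Module A J := Module.compHom J f
        ∀ 𝔭 : PrimeSpectrum A, 𝔭 ∈ Module.support A J →
          (kgr (Localization.AtPrime 𝔭.asIdeal)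
              (IsLocalRing.maximalIdeal (Localization.AtPrime 𝔭.asIdeal))
              (LocalizedModule 𝔭.asIdeal.primeCompl J) : WithBot ℕ∞) =
            ringKrullDim (Localization.AtPrime 𝔭.asIdeal)) := by
  let : Module A J := Module.compHom J f
  rw [isCMIdeals_and_forall_localization_iff]
  refine isCMIdeals_iff_of_addEquiv (ι := amalgIota f J) (π := amalgFst f J) (fun _ => rfl)
    (ker_amalgFst_le_nilradical f hJ) (amalgAddEquiv f J) fun a z => ?_
  refine Subtype.ext (Prod.ext rfl ?_)
  change f (a * z.1) + f a * z.2 = f a * (f z.1 + z.2)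
  rw [map_mul, mul_add]
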